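/- arXiv:0911.0941 — 8 statements merged into one kernel-verified Lean document; each statement's English description precedes it below -/
import Mathlib

section
/- Under the Gaussian factorization S g = S̄ of the semi-infinite block matrix g, the associated families of matrix polynomials are biorthogonal with respect to the pairing induced by g: for all i, j ≥ 0, ⟨p_i, p̄_j⟩ = δ_{ij} I_N. -/
open Matrix Finset

/-- Under the Gaussian factorization S g = S̄ of the semi-infinite block
matrix g, the associated matrix polynomials `p_i(z) = Σ_{k≤i} S_{ik} z^k` and
`p̄_j(z) = Σ_{l≤j} ((S̄⁻¹)_{lj})^† z^l` are biorthogonal with respect to the pairing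
`⟨P,Q⟩ = Σ_{k,l} P_k g_{kl} Q_l^†` induced by `g`: `⟨p_i, p̄_j⟩ = δ_{ij} I_N`. -/
theorem biorthogonality_of_gaussian_factorization
    (N : ℕ) (hN : 1 ≤ N)
    (g S Sinv Sb Sbinv : ℕ → ℕ → Matrix (Fin N) (Fin N) ℂ)
    -- S is block lower unitriangular
    (hS_diag : ∀ i, S i i = 1)
    (hS_tri : ∀ i j, i < j → S i j = 0)
    -- with block lower unitriangular two-sided inverse S⁻¹
    (hSinv_diag : ∀ i, Sinv i i = 1)
    (hSinv_tri : ∀ i j, i < j → Sinv i j = 0)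
    (hSSinv : ∀ i j, ∑ k ∈ Finset.range (i + 1), S i k * Sinv k j
      = if i = j then 1 else 0)
    (hSinvS : ∀ i j, ∑ k ∈ Finset.range (i + 1), Sinv i k * S k j
      = if i = j then 1 else 0)
    -- S̄ is block upper triangular with invertible diagonal blocks
    (hSb_tri : ∀ i j, j < i → Sb i j = 0)
    (hSb_diag : ∀ i, IsUnit (Sb i i))
    -- with block upper triangular two-sided inverse S̄⁻¹
    (hSbinv_tri : ∀ i j, j < i → Sbinv i j = 0)
    (hSbSbinv : ∀ i j, ∑ k ∈ Finset.range (j + 1), Sb i k * Sbinv k j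
      = if i = j then 1 else 0)
    (hSbinvSb : ∀ i j, ∑ k ∈ Finset.range (j + 1), Sbinv i k * Sb k j
      = if i = j then 1 else 0)
    -- the factorization S g = S̄
    (hfact : ∀ i j, ∑ k ∈ Finset.range (i + 1), S i k * g k j = Sb i j) :
    -- ⟨p_i, p̄_j⟩ = Σ_{k≤i} Σ_{l≤j} (p_i)_k g_{kl} ((p̄_j)_l)^† = δ_{ij} I_N,
    -- where (p_i)_k = S_{ik} and (p̄_j)_l = ((S̄⁻¹)_{lj})^†.
    ∀ i j, ∑ k ∈ Finset.range (i + 1), ∑ l ∈ Finset.range (j + 1),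
        S i k * g k l * ((Sbinv l j)ᴴ)ᴴ = if i = j then 1 else 0 := by
  intro i j
  simp only [conjTranspose_conjTranspose]
  rw [Finset.sum_comm, ← hSbSbinv i j]
  refine Finset.sum_congr rfl fun l _ => ?_
  rw [← hfact i l, Finset.sum_mul]
end

section
/- Under the Gaussian factorization S g = S̄ of the semi-infinite block matrix g, the matrix polynomials p_i and p̄_j satisfy the orthogonality relations ⟨p_i(z), z^l I_N⟩ = 0 for l = 0, …, i−1 and ⟨z^l I_N, p̄_j(z)⟩ = 0 for l = 0, …, j−1. -/
open Matrix Finset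

/-- Under the Gaussian factorization S g = S̄, the matrix polynomials
`p_i(z) = Σ_{k≤i} S_{ik} z^k` and `p̄_j(z) = Σ_{l≤j} ((S̄⁻¹)_{lj})^† z^l` satisfy the
orthogonality relations `⟨p_i(z), z^l I_N⟩ = 0` for `l = 0,…,i−1` and
`⟨z^l I_N, p̄_j(z)⟩ = 0` for `l = 0,…,j−1`, where `⟨P,Q⟩ = Σ_{k,l} P_k g_{kl} Q_l^†`. -/
theorem orthogonality_relations_of_gaussian_factorization
    (N : ℕ) (hN : 1 ≤ N)
    (g S Sinv Sb Sbinv : ℕ → ℕ → Matrix (Fin N) (Fin N) ℂ)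
    -- S is block lower unitriangular
    (hS_diag : ∀ i, S i i = 1)
    (hS_tri : ∀ i j, i < j → S i j = 0)
    -- with block lower unitriangular two-sided inverse S⁻¹
    (hSinv_diag : ∀ i, Sinv i i = 1)
    (hSinv_tri : ∀ i j, i < j → Sinv i j = 0)
    (hSSinv : ∀ i j, ∑ k ∈ Finset.range (i + 1), S i k * Sinv k j
      = if i = j then 1 else 0)
    (hSinvS : ∀ i j, ∑ k ∈ Finset.range (i + 1), Sinv i k * S k j
      = if i = j then 1 else 0)
    -- S̄ is block upper triangular with invertible diagonal blocks
    (hSb_tri : ∀ i j, j < i → Sb i j = 0)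
    (hSb_diag : ∀ i, IsUnit (Sb i i))
    -- with block upper triangular two-sided inverse S̄⁻¹
    (hSbinv_tri : ∀ i j, j < i → Sbinv i j = 0)
    (hSbSbinv : ∀ i j, ∑ k ∈ Finset.range (j + 1), Sb i k * Sbinv k j
      = if i = j then 1 else 0)
    (hSbinvSb : ∀ i j, ∑ k ∈ Finset.range (j + 1), Sbinv i k * Sb k j
      = if i = j then 1 else 0)
    -- the factorization S g = S̄
    (hfact : ∀ i j, ∑ k ∈ Finset.range (i + 1), S i k * g k j = Sb i j) :
    -- ⟨p_i(z), z^l I_N⟩ = Σ_{k≤i} S_{ik} g_{kl} (I_N)^† = 0 for l = 0,…,i−1, and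
    -- ⟨z^l I_N, p̄_j(z)⟩ = Σ_{m≤j} I_N g_{lm} (((S̄⁻¹)_{mj})^†)^† = 0 for l = 0,…,j−1.
    (∀ i l, l < i →
      ∑ k ∈ Finset.range (i + 1), S i k * g k l * (1 : Matrix (Fin N) (Fin N) ℂ)ᴴ = 0)
    ∧ (∀ j l, l < j →
      ∑ m ∈ Finset.range (j + 1),
        (1 : Matrix (Fin N) (Fin N) ℂ) * g l m * ((Sbinv m j)ᴴ)ᴴ = 0) := by
  refine ⟨fun i l hl => ?_, fun j l hl => ?_⟩
  · simpa [hfact] using hSb_tri i l hl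
  · simp only [one_mul, conjTranspose_conjTranspose]
    induction l using Nat.strong_induction_on with
    | _ l ih =>
      have key : ∑ k ∈ Finset.range (l + 1),
          S l k * ∑ m ∈ Finset.range (j + 1), g k m * Sbinv m j = 0 := by
        have h := hSbSbinv l j
        rw [if_neg hl.ne] at h
        rw [← h]
        simp_rw [← hfact, Finset.mul_sum, Finset.sum_mul, Matrix.mul_assoc]
        exact Finset.sum_comm
      rw [Finset.sum_range_succ, hS_diag, one_mul, Finset.sum_eq_zero, zero_add] at key
      · exact key
      · intro k hk
        have hkl := Finset.mem_range.mp hk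
        rw [ih k hkl (hkl.trans hl), mul_zero]
end

section
/- Suppose the semi-infinite block matrix g admits a Gaussian factorization S g = S̄ and is Hermitian, i.e. (g_{ij})^† = g_{ji} for all i, j. Then the block matrix H := S̄ S^†, with entries H_{ij} = Σ_k S̄_{ik} (S_{jk})^† (a finite sum), is block diagonal with Hermitian diagonal blocks: H_{ij} = 0 for i ≠ j and (H_{ii})^† = H_{ii}. Consequently ⟨p_i, p_j⟩ = δ_{ij} H_{ii}, i.e. the polynomials p_i form a family of matrix orthogonal polynomials. -/
open Matrix Finset

section MomentMatrix

variable {n R : Type*} [Fintype n] [NonUnitalSemiring R]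
  {g S Sb : ℕ → ℕ → Matrix n n R}

/-- Under `S g = S̄`, the pairing of the polynomials with coefficient rows `S i` and `S j`
is the block `(S̄ S^†)_{ij}`. -/
lemma sum_mul_moment_mul_conjTranspose [StarRing R]
    (hfact : ∀ i j, ∑ k ∈ range (i + 1), S i k * g k j = Sb i j) (i j : ℕ) :
    ∑ k ∈ range (i + 1), ∑ l ∈ range (j + 1), S i k * g k l * (S j l)ᴴ
      = ∑ l ∈ range (j + 1), Sb i l * (S j l)ᴴ := by
  rw [sum_comm]
  exact sum_congr rfl fun l _ => by rw [← hfact, Finset.sum_mul]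

/-- The pairing induced by a Hermitian moment matrix is Hermitian. -/
lemma conjTranspose_sum_mul_moment_mul_conjTranspose [StarRing R]
    (hherm : ∀ i j, (g i j)ᴴ = g j i) (i j : ℕ) :
    (∑ k ∈ range (i + 1), ∑ l ∈ range (j + 1), S i k * g k l * (S j l)ᴴ)ᴴ
      = ∑ k ∈ range (j + 1), ∑ l ∈ range (i + 1), S j k * g k l * (S i l)ᴴ := by
  rw [sum_comm]
  simp only [conjTranspose_sum, conjTranspose_mul, conjTranspose_conjTranspose, hherm,
    Matrix.mul_assoc]

/-- If `S̄` is block upper triangular, `S̄ S^†` vanishes strictly below the diagonal. -/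
lemma sum_upper_mul_conjTranspose_eq_zero [StarRing R]
    (hSb_tri : ∀ i j, j < i → Sb i j = 0) {i j : ℕ} (hij : j < i) :
    ∑ k ∈ range (j + 1), Sb i k * (S j k)ᴴ = 0 :=
  sum_eq_zero fun k hk => by
    rw [hSb_tri i k (by have := mem_range.1 hk; lia), Matrix.zero_mul]

end MomentMatrix

/-- If g admits a Gaussian factorization S g = S̄ and is Hermitian
((g_{ij})^† = g_{ji}), then H := S̄ S^†, with blocks H_{ij} = Σ_k S̄_{ik} (S_{jk})^†,
is block diagonal with Hermitian diagonal blocks, and the matrix polynomials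
p_i(z) = Σ_{k≤i} S_{ik} z^k satisfy ⟨p_i, p_j⟩ = δ_{ij} H_{ii} for the pairing
⟨P,Q⟩ = Σ_{k,l} P_k g_{kl} Q_l^†. -/
theorem matrix_orthogonality_of_hermitian_moment_matrix
    (N : ℕ) (hN : 1 ≤ N)
    (g S Sinv Sb Sbinv : ℕ → ℕ → Matrix (Fin N) (Fin N) ℂ)
    -- S is block lower unitriangular
    (hS_diag : ∀ i, S i i = 1)
    (hS_tri : ∀ i j, i < j → S i j = 0)
    -- with block lower unitriangular two-sided inverse S⁻¹
    (hSinv_diag : ∀ i, Sinv i i = 1)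
    (hSinv_tri : ∀ i j, i < j → Sinv i j = 0)
    (hSSinv : ∀ i j, ∑ k ∈ Finset.range (i + 1), S i k * Sinv k j
      = if i = j then 1 else 0)
    (hSinvS : ∀ i j, ∑ k ∈ Finset.range (i + 1), Sinv i k * S k j
      = if i = j then 1 else 0)
    -- S̄ is block upper triangular with invertible diagonal blocks
    (hSb_tri : ∀ i j, j < i → Sb i j = 0)
    (hSb_diag : ∀ i, IsUnit (Sb i i))
    -- with block upper triangular two-sided inverse S̄⁻¹
    (hSbinv_tri : ∀ i j, j < i → Sbinv i j = 0)
    (hSbSbinv : ∀ i j, ∑ k ∈ Finset.range (j + 1), Sb i k * Sbinv k j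
      = if i = j then 1 else 0)
    (hSbinvSb : ∀ i j, ∑ k ∈ Finset.range (j + 1), Sbinv i k * Sb k j
      = if i = j then 1 else 0)
    -- the factorization S g = S̄
    (hfact : ∀ i j, ∑ k ∈ Finset.range (i + 1), S i k * g k j = Sb i j)
    -- g is Hermitian
    (hherm : ∀ i j, (g i j)ᴴ = g j i) :
    -- H_{ij} = Σ_k S̄_{ik} (S_{jk})^†, a finite sum since S_{jk} = 0 for k > j
    (∀ i j, i ≠ j →
      ∑ k ∈ Finset.range (j + 1), Sb i k * (S j k)ᴴ = 0)
    ∧ (∀ i, (∑ k ∈ Finset.range (i + 1), Sb i k * (S i k)ᴴ)ᴴ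
        = ∑ k ∈ Finset.range (i + 1), Sb i k * (S i k)ᴴ)
    ∧ (∀ i j, ∑ k ∈ Finset.range (i + 1), ∑ l ∈ Finset.range (j + 1),
        S i k * g k l * (S j l)ᴴ
        = if i = j then ∑ k ∈ Finset.range (i + 1), Sb i k * (S i k)ᴴ else 0) := by
  have hpair := sum_mul_moment_mul_conjTranspose hfact
  have hconj (i j : ℕ) : (∑ k ∈ range (j + 1), Sb i k * (S j k)ᴴ)ᴴ
      = ∑ k ∈ range (i + 1), Sb j k * (S i k)ᴴ := by
    rw [← hpair, ← hpair, conjTranspose_sum_mul_moment_mul_conjTranspose hherm]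
  have hzero (i j : ℕ) (hij : i ≠ j) : ∑ k ∈ range (j + 1), Sb i k * (S j k)ᴴ = 0 := by
    rcases hij.lt_or_gt with h | h
    · rw [← hconj, sum_upper_mul_conjTranspose_eq_zero hSb_tri h, conjTranspose_zero]
    · exact sum_upper_mul_conjTranspose_eq_zero hSb_tri h
  refine ⟨hzero, fun i => hconj i i, fun i j => ?_⟩
  rw [hpair]
  split_ifs with h
  · rw [h]
  · exact hzero i j h
end

section
/- Suppose the semi-infinite block matrix g admits a Gaussian factorization S g = S̄ and is Hermitian, i.e. (g_{ij})^† = g_{ji} for all i, j. Then the two families of matrix polynomials are proportional: for every i ≥ 0, p̄_i(z) = (H_{ii})^{-1} p_i(z) as matrix polynomials, where H_{ii} := Σ_k S̄_{ik}(S_{ik})^† is the i-th diagonal block of S̄ S^† (which is invertible and Hermitian). -/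
open Matrix Finset

section GaussianFactorization

variable {R : Type*} [Ring R]

/-- The `(i, j)` entry of `S̄ S^†` equals the `(i, j)` entry of `S g S^†`, hence is Hermitian
when `g` is. -/
theorem star_sum_upper_mul_star_lower [StarRing R] {g S U : ℕ → ℕ → R}
    (hfact : ∀ i j, ∑ k ∈ range (i + 1), S i k * g k j = U i j)
    (hg : ∀ i j, star (g i j) = g j i) (i j : ℕ) :
    star (∑ k ∈ range (j + 1), U i k * star (S j k))
      = ∑ k ∈ range (i + 1), U j k * star (S i k) := by
  simp only [← hfact, star_sum, star_mul, star_star, hg, sum_mul, mul_assoc]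
  exact sum_comm

/-- If `U` is upper triangular, then the entries of `U S^†` strictly below the diagonal vanish. -/
theorem sum_upper_mul_star_lower_eq_zero [Star R] {S U : ℕ → ℕ → R}
    (hU : ∀ i j, j < i → U i j = 0) {i j : ℕ} (hij : j < i) :
    ∑ k ∈ range (j + 1), U i k * star (S j k) = 0 :=
  sum_eq_zero fun k hk => by
    rw [hU i k ((Nat.lt_succ_iff.mp (mem_range.mp hk)).trans_lt hij), zero_mul]

/-- If `U` is upper triangular and `S` has unit diagonal, then the diagonal of `U S^†` is that
of `U`. -/
theorem sum_upper_mul_star_lower_diag [StarRing R] {S U : ℕ → ℕ → R}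
    (hU : ∀ i j, j < i → U i j = 0) (hS : ∀ i, S i i = 1) (i : ℕ) :
    ∑ k ∈ range (i + 1), U i k * star (S i k) = U i i := by
  rw [sum_range_succ, hS, star_one, mul_one, sum_eq_zero, zero_add]
  intro k hk
  rw [hU i k (mem_range.mp hk), zero_mul]

/-- A left inverse of an upper triangular semi-infinite matrix can be cancelled against vectors
supported on `{0, …, n}`. -/
theorem sum_leftInverse_mul_sum_upper_mul {U V : ℕ → ℕ → R}
    (hU : ∀ i j, j < i → U i j = 0)
    (hVU : ∀ i j, ∑ k ∈ range (j + 1), V i k * U k j = if i = j then 1 else 0)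
    (x : ℕ → R) {l n : ℕ} (hl : l ≤ n) :
    ∑ k ∈ range (n + 1), V l k * ∑ m ∈ range (n + 1), U k m * x m = x l := by
  have extend : ∀ m ∈ range (n + 1),
      ∑ k ∈ range (n + 1), V l k * U k m = if l = m then 1 else 0 := by
    intro m hm
    rw [← hVU l m]
    refine (sum_subset (range_mono (mem_range.mp hm)) fun k _ hk => ?_).symm
    rw [hU k m (by simpa [Nat.lt_succ_iff] using hk), mul_zero]
  simp_rw [mul_sum, ← mul_assoc]
  rw [sum_comm]
  simp_rw [← sum_mul]
  rw [sum_congr rfl fun m hm => by rw [extend m hm]]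
  simp [hl]

/-- For a Hermitian `g` with Gaussian factorization `S g = U`, the left inverse `V` of `U`
satisfies `V H = S^†` with `H` the diagonal of `U`. -/
theorem leftInverse_mul_diag_eq_star_lower [StarRing R] {g S U V : ℕ → ℕ → R}
    (hS_tri : ∀ i j, i < j → S i j = 0) (hS : ∀ i, S i i = 1)
    (hU : ∀ i j, j < i → U i j = 0) (hV : ∀ i j, j < i → V i j = 0)
    (hVU : ∀ i j, ∑ k ∈ range (j + 1), V i k * U k j = if i = j then 1 else 0)
    (hfact : ∀ i j, ∑ k ∈ range (i + 1), S i k * g k j = U i j)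
    (hg : ∀ i j, star (g i j) = g j i) (l i : ℕ) :
    V l i * U i i = star (S i l) := by
  rcases lt_or_ge i l with hil | hli
  · rw [hV l i hil, hS_tri i l hil, zero_mul, star_zero]
  · rw [← sum_leftInverse_mul_sum_upper_mul hU hVU (fun m => star (S i m)) hli,
      sum_range_succ, sum_upper_mul_star_lower_diag hU hS, sum_eq_zero, zero_add]
    intro k hk
    rw [← star_star (∑ m ∈ range (i + 1), U k m * star (S i m)),
      star_sum_upper_mul_star_lower hfact hg,
      sum_upper_mul_star_lower_eq_zero hU (mem_range.mp hk), star_zero, mul_zero]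

end GaussianFactorization

/-- If g admits a Gaussian factorization S g = S̄ and is Hermitian, then
the two families of matrix polynomials are proportional: p̄_i(z) = (H_{ii})⁻¹ p_i(z),
coefficientwise ((S̄⁻¹)_{li})^† = (H_{ii})⁻¹ S_{il}, where
H_{ii} = Σ_k S̄_{ik} (S_{ik})^† is the i-th diagonal block of S̄ S^†, which is
invertible and Hermitian. -/
theorem proportionality_of_biorthogonal_families
    (N : ℕ) (hN : 1 ≤ N)
    (g S Sinv Sb Sbinv : ℕ → ℕ → Matrix (Fin N) (Fin N) ℂ)
    -- S is block lower unitriangular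
    (hS_diag : ∀ i, S i i = 1)
    (hS_tri : ∀ i j, i < j → S i j = 0)
    -- with block lower unitriangular two-sided inverse S⁻¹
    (hSinv_diag : ∀ i, Sinv i i = 1)
    (hSinv_tri : ∀ i j, i < j → Sinv i j = 0)
    (hSSinv : ∀ i j, ∑ k ∈ Finset.range (i + 1), S i k * Sinv k j
      = if i = j then 1 else 0)
    (hSinvS : ∀ i j, ∑ k ∈ Finset.range (i + 1), Sinv i k * S k j
      = if i = j then 1 else 0)
    -- S̄ is block upper triangular with invertible diagonal blocks
    (hSb_tri : ∀ i j, j < i → Sb i j = 0)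
    (hSb_diag : ∀ i, IsUnit (Sb i i))
    -- with block upper triangular two-sided inverse S̄⁻¹
    (hSbinv_tri : ∀ i j, j < i → Sbinv i j = 0)
    (hSbSbinv : ∀ i j, ∑ k ∈ Finset.range (j + 1), Sb i k * Sbinv k j
      = if i = j then 1 else 0)
    (hSbinvSb : ∀ i j, ∑ k ∈ Finset.range (j + 1), Sbinv i k * Sb k j
      = if i = j then 1 else 0)
    -- the factorization S g = S̄
    (hfact : ∀ i j, ∑ k ∈ Finset.range (i + 1), S i k * g k j = Sb i j)
    -- g is Hermitian
    (hherm : ∀ i j, (g i j)ᴴ = g j i) :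
    ∀ i,
      IsUnit (∑ k ∈ Finset.range (i + 1), Sb i k * (S i k)ᴴ)
      ∧ (∑ k ∈ Finset.range (i + 1), Sb i k * (S i k)ᴴ)ᴴ
          = ∑ k ∈ Finset.range (i + 1), Sb i k * (S i k)ᴴ
      ∧ ∀ l, (Sbinv l i)ᴴ
          = (∑ k ∈ Finset.range (i + 1), Sb i k * (S i k)ᴴ)⁻¹ * S i l := by
  intro i
  have hdiag : ∑ k ∈ range (i + 1), Sb i k * (S i k)ᴴ = Sb i i :=
    sum_upper_mul_star_lower_diag hSb_tri hS_diag i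
  have hsymm : (Sb i i)ᴴ = Sb i i := by
    rw [← hdiag]
    exact star_sum_upper_mul_star_lower hfact hherm i i
  rw [hdiag]
  refine ⟨hSb_diag i, hsymm, fun l => ?_⟩
  have hmul : Sbinv l i * Sb i i = (S i l)ᴴ :=
    leftInverse_mul_diag_eq_star_lower hS_tri hS_diag hSb_tri hSbinv_tri hSbinvSb hfact hherm l i
  have hS_eq : S i l = Sb i i * (Sbinv l i)ᴴ := by
    rw [← conjTranspose_conjTranspose (S i l), ← hmul, conjTranspose_mul, hsymm]
  rw [hS_eq, nonsing_inv_mul_cancel_left _ _ ((isUnit_iff_isUnit_det _).mp (hSb_diag i))]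
end

section
/- Suppose the semi-infinite block matrix g admits a Gaussian factorization S g = S̄ and is block Hänkel, i.e. g_{i+1,j} = g_{i,j+1} for all i, j. Then L = L̄, where L := S Λ S⁻¹ has entries L_{ij} = Σ_k S_{ik} (S⁻¹)_{k+1,j} and L̄ := S̄ Λᵗ S̄⁻¹ has entries L̄_{ij} = Σ_{l≥1} S̄_{il} (S̄⁻¹)_{l−1,j}. Consequently L is block tridiagonal: L_{ij} = 0 unless i−1 ≤ j ≤ i+1, and L_{i,i+1} = I_N for all i. -/
open Matrix Finset

/-- A sum over an initial segment may be extended past the support. -/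
theorem sum_range_extend {R : Type*} [AddCommMonoid R] {f : ℕ → R} {a M : ℕ} (haM : a ≤ M)
    (hf : ∀ k, a ≤ k → f k = 0) : ∑ k ∈ Finset.range a, f k = ∑ k ∈ Finset.range M, f k :=
  Finset.sum_subset (Finset.range_mono haM) fun k _ hk =>
    hf k (not_lt.mp fun h => hk (Finset.mem_range.mpr h))

/-- Associativity of the product row vector times matrix times column vector. -/
theorem sum_mul_sum_assoc {R : Type*} [Semiring R] (s t : Finset ℕ) (a : ℕ → R)
    (b : ℕ → ℕ → R) (c : ℕ → R) :
    ∑ k ∈ s, a k * ∑ l ∈ t, b k l * c l = ∑ l ∈ t, (∑ k ∈ s, a k * b k l) * c l := by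
  simp only [Finset.mul_sum, Finset.sum_mul, mul_assoc]
  exact Finset.sum_comm

/-- If `S g = Sb` with `S` lower triangular with left inverse `Sinv`, then `g = Sinv Sb`. -/
theorem eq_sum_inv_mul_of_factorization {R : Type*} [Semiring R] {g S Sinv Sb : ℕ → ℕ → R}
    (hS_tri : ∀ i j, i < j → S i j = 0) (hSinv_tri : ∀ i j, i < j → Sinv i j = 0)
    (hSinvS : ∀ i j, ∑ k ∈ Finset.range (i + 1), Sinv i k * S k j = if i = j then 1 else 0)
    (hfact : ∀ i j, ∑ k ∈ Finset.range (i + 1), S i k * g k j = Sb i j)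
    {i M : ℕ} (hi : i < M) (j : ℕ) :
    g i j = ∑ m ∈ Finset.range M, Sinv i m * Sb m j := by
  have hSb : ∀ m ∈ Finset.range M, Sinv i m * Sb m j
      = Sinv i m * ∑ k ∈ Finset.range M, S m k * g k j := fun m hm => by
    rw [← hfact, sum_range_extend (Finset.mem_range.mp hm)]
    exact fun k hk => by rw [hS_tri m k hk, zero_mul]
  have hδ : ∀ k, ∑ m ∈ Finset.range M, Sinv i m * S m k = if i = k then 1 else 0 := fun k => by
    rw [← hSinvS, sum_range_extend (a := i + 1) hi]
    exact fun m hm => by rw [hSinv_tri i m hm, zero_mul]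
  rw [Finset.sum_congr rfl hSb, sum_mul_sum_assoc]
  simp [hδ, hi]

/-- For a Hänkel `g`, the product of `S Λ S⁻¹` with `Sb` is `Sb Λᵗ`. -/
theorem sum_lax_mul_upper {R : Type*} [Semiring R] {g S Sinv Sb : ℕ → ℕ → R}
    (hS_tri : ∀ i j, i < j → S i j = 0) (hSinv_tri : ∀ i j, i < j → Sinv i j = 0)
    (hSinvS : ∀ i j, ∑ k ∈ Finset.range (i + 1), Sinv i k * S k j = if i = j then 1 else 0)
    (hfact : ∀ i j, ∑ k ∈ Finset.range (i + 1), S i k * g k j = Sb i j)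
    (hhankel : ∀ i j, g (i + 1) j = g i (j + 1)) {i M : ℕ} (hi : i + 1 < M) (m : ℕ) :
    ∑ p ∈ Finset.range M, (∑ k ∈ Finset.range (i + 1), S i k * Sinv (k + 1) p) * Sb p m
      = Sb i (m + 1) := by
  rw [← sum_mul_sum_assoc, ← hfact]
  refine Finset.sum_congr rfl fun k hk => ?_
  have hk' := Finset.mem_range.mp hk
  rw [← hhankel, eq_sum_inv_mul_of_factorization hS_tri hSinv_tri hSinvS hfact
    (show k + 1 < M by omega)]

/-- For a Hänkel `g` with Gaussian factorization `S g = Sb`, `S Λ S⁻¹ = Sb Λᵗ Sb⁻¹`. -/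
theorem lax_eq_of_hankel {R : Type*} [Semiring R] {g S Sinv Sb Sbinv : ℕ → ℕ → R}
    (hS_tri : ∀ i j, i < j → S i j = 0) (hSinv_tri : ∀ i j, i < j → Sinv i j = 0)
    (hSinvS : ∀ i j, ∑ k ∈ Finset.range (i + 1), Sinv i k * S k j = if i = j then 1 else 0)
    (hSbSbinv : ∀ i j, ∑ k ∈ Finset.range (j + 1), Sb i k * Sbinv k j = if i = j then 1 else 0)
    (hfact : ∀ i j, ∑ k ∈ Finset.range (i + 1), S i k * g k j = Sb i j)
    (hhankel : ∀ i j, g (i + 1) j = g i (j + 1)) (i j : ℕ) :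
    ∑ k ∈ Finset.range (i + 1), S i k * Sinv (k + 1) j
      = ∑ l ∈ Finset.Icc 1 (j + 1), Sb i l * Sbinv (l - 1) j := by
  have hshift : ∑ l ∈ Finset.Icc 1 (j + 1), Sb i l * Sbinv (l - 1) j
      = ∑ l ∈ Finset.range (j + 1), Sb i (l + 1) * Sbinv l j := by
    rw [← Finset.Ico_succ_right_eq_Icc, Finset.sum_Ico_eq_sum_range]
    simp [add_comm 1]
  have hM : i + 1 < i + j + 2 := by omega
  rw [hshift]
  simp only [← sum_lax_mul_upper hS_tri hSinv_tri hSinvS hfact hhankel hM]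
  rw [← sum_mul_sum_assoc]
  simp only [hSbSbinv]
  simp [show j < i + j + 2 by omega]

/-- If g admits a Gaussian factorization S g = S̄ and is block Hänkel
(g_{i+1,j} = g_{i,j+1}), then L = L̄, where L_{ij} = Σ_k S_{ik} (S⁻¹)_{k+1,j} and
L̄_{ij} = Σ_{l≥1} S̄_{il} (S̄⁻¹)_{l−1,j}; consequently L is block tridiagonal
(L_{ij} = 0 unless i−1 ≤ j ≤ i+1) and L_{i,i+1} = I_N. -/
theorem hankel_reduction_lax_tridiagonal
    (N : ℕ) (hN : 1 ≤ N)
    (g S Sinv Sb Sbinv : ℕ → ℕ → Matrix (Fin N) (Fin N) ℂ)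
    -- S is block lower unitriangular
    (hS_diag : ∀ i, S i i = 1)
    (hS_tri : ∀ i j, i < j → S i j = 0)
    -- with block lower unitriangular two-sided inverse S⁻¹
    (hSinv_diag : ∀ i, Sinv i i = 1)
    (hSinv_tri : ∀ i j, i < j → Sinv i j = 0)
    (hSSinv : ∀ i j, ∑ k ∈ Finset.range (i + 1), S i k * Sinv k j
      = if i = j then 1 else 0)
    (hSinvS : ∀ i j, ∑ k ∈ Finset.range (i + 1), Sinv i k * S k j
      = if i = j then 1 else 0)
    -- S̄ is block upper triangular with invertible diagonal blocks
    (hSb_tri : ∀ i j, j < i → Sb i j = 0)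
    (hSb_diag : ∀ i, IsUnit (Sb i i))
    -- with block upper triangular two-sided inverse S̄⁻¹
    (hSbinv_tri : ∀ i j, j < i → Sbinv i j = 0)
    (hSbSbinv : ∀ i j, ∑ k ∈ Finset.range (j + 1), Sb i k * Sbinv k j
      = if i = j then 1 else 0)
    (hSbinvSb : ∀ i j, ∑ k ∈ Finset.range (j + 1), Sbinv i k * Sb k j
      = if i = j then 1 else 0)
    -- the factorization S g = S̄
    (hfact : ∀ i j, ∑ k ∈ Finset.range (i + 1), S i k * g k j = Sb i j)
    -- g is block Hänkel
    (hhankel : ∀ i j, g (i + 1) j = g i (j + 1)) :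
    (∀ i j, ∑ k ∈ Finset.range (i + 1), S i k * Sinv (k + 1) j
        = ∑ l ∈ Finset.Icc 1 (j + 1), Sb i l * Sbinv (l - 1) j)
    ∧ (∀ i j, (j + 1 < i ∨ i + 1 < j) →
        ∑ k ∈ Finset.range (i + 1), S i k * Sinv (k + 1) j = 0)
    ∧ (∀ i, ∑ k ∈ Finset.range (i + 1), S i k * Sinv (k + 1) (i + 1) = 1) := by
  have hL := lax_eq_of_hankel hS_tri hSinv_tri hSinvS hSbSbinv hfact hhankel
  refine ⟨hL, fun i j hij => ?_, fun i => ?_⟩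
  · rcases hij with hij | hij
    · rw [hL]
      refine Finset.sum_eq_zero fun l hl => ?_
      rw [hSb_tri i l ((Finset.mem_Icc.mp hl).2.trans_lt hij), zero_mul]
    · refine Finset.sum_eq_zero fun k hk => ?_
      have hk' := Finset.mem_range.mp hk
      rw [hSinv_tri (k + 1) j (by omega), mul_zero]
  · rw [Finset.sum_range_succ, Finset.sum_eq_zero, hS_diag, hSinv_diag, one_mul, zero_add]
    intro k hk
    have hk' := Finset.mem_range.mp hk
    rw [hSinv_tri (k + 1) (i + 1) (by omega), mul_zero]
end

section
/- Suppose the semi-infinite block matrix g admits a Gaussian factorization S g = S̄ and is block Hänkel (g_{i+1,j} = g_{i,j+1} for all i, j). Then the matrix polynomials p_i satisfy the three-term recurrence relation z p_i(z) = p_{i+1}(z) + L_{ii} p_i(z) + L_{i,i−1} p_{i−1}(z) for all i ≥ 0 (with the convention p_{−1} := 0), where L_{ij} := Σ_k S_{ik} (S⁻¹)_{k+1,j} are the blocks of L = S Λ S⁻¹. -/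
open Matrix Finset

/-- If `T` is a lower triangular left inverse of the lower triangular matrix `S`, then multiplying
`S X` on the left by the shifted product `S Λ T` gives `S Λ X`. -/
theorem sum_shiftConj_mul {R : Type*} [Ring R] {S T : ℕ → ℕ → R}
    (hS : ∀ i j, i < j → S i j = 0) (hT : ∀ i j, i < j → T i j = 0)
    (hTS : ∀ i j, ∑ k ∈ Finset.range (i + 1), T i k * S k j = if i = j then 1 else 0)
    (X : ℕ → R) (i : ℕ) :
    ∑ j ∈ Finset.range (i + 2), (∑ k ∈ Finset.range (i + 1), S i k * T (k + 1) j) *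
        (∑ l ∈ Finset.range (j + 1), S j l * X l)
      = ∑ k ∈ Finset.range (i + 1), S i k * X (k + 1) := by
  have extend : ∀ (A : ℕ → ℕ → R), (∀ i j, i < j → A i j = 0) → ∀ (Y : ℕ → R) (j n : ℕ), j < n →
      ∑ l ∈ Finset.range n, A j l * Y l = ∑ l ∈ Finset.range (j + 1), A j l * Y l := by
    intro A hA Y j n hj
    refine (Finset.sum_subset (Finset.range_mono hj) fun l _ hl => ?_).symm
    rw [hA j l (by simpa using hl), zero_mul]
  have inner : ∀ k ∈ Finset.range (i + 1), ∑ j ∈ Finset.range (i + 2), T (k + 1) j *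
      (∑ l ∈ Finset.range (j + 1), S j l * X l) = X (k + 1) := by
    intro k hk
    have hk' : k + 1 < i + 2 := by simpa using hk
    calc _ = ∑ j ∈ Finset.range (i + 2), ∑ l ∈ Finset.range (i + 2),
              T (k + 1) j * S j l * X l := by
          refine Finset.sum_congr rfl fun j hj => ?_
          rw [← extend S hS X j (i + 2) (Finset.mem_range.1 hj), Finset.mul_sum]
          simp only [mul_assoc]
      _ = ∑ l ∈ Finset.range (i + 2), (if k + 1 = l then 1 else 0) * X l := by
          rw [Finset.sum_comm]
          refine Finset.sum_congr rfl fun l _ => ?_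
          rw [← Finset.sum_mul, extend T hT (fun j => S j l) _ _ hk', hTS]
      _ = X (k + 1) := by
          simp only [ite_mul, one_mul, zero_mul, Finset.sum_ite_eq, Finset.mem_range, if_pos hk']
  simp_rw [Finset.sum_mul]
  rw [Finset.sum_comm]
  refine Finset.sum_congr rfl fun k hk => ?_
  simp_rw [mul_assoc]
  rw [← Finset.mul_sum, inner k hk]

/-- If g admits a Gaussian factorization S g = S̄ and is block Hänkel,
then the matrix polynomials p_i(z) = Σ_{k≤i} S_{ik} z^k satisfy the three-term
recurrence z p_i(z) = p_{i+1}(z) + L_{ii} p_i(z) + L_{i,i−1} p_{i−1}(z) (with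
p_{−1} := 0), where L_{ij} = Σ_k S_{ik} (S⁻¹)_{k+1,j}. The case i = 0 and the cases
i ≥ 1 are stated separately so that p_{−1} = 0 is built in. -/
theorem hankel_three_term_recurrence
    (N : ℕ) (hN : 1 ≤ N)
    (g S Sinv Sb Sbinv : ℕ → ℕ → Matrix (Fin N) (Fin N) ℂ)
    -- S is block lower unitriangular
    (hS_diag : ∀ i, S i i = 1)
    (hS_tri : ∀ i j, i < j → S i j = 0)
    -- with block lower unitriangular two-sided inverse S⁻¹
    (hSinv_diag : ∀ i, Sinv i i = 1)
    (hSinv_tri : ∀ i j, i < j → Sinv i j = 0)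
    (hSSinv : ∀ i j, ∑ k ∈ Finset.range (i + 1), S i k * Sinv k j
      = if i = j then 1 else 0)
    (hSinvS : ∀ i j, ∑ k ∈ Finset.range (i + 1), Sinv i k * S k j
      = if i = j then 1 else 0)
    -- S̄ is block upper triangular with invertible diagonal blocks
    (hSb_tri : ∀ i j, j < i → Sb i j = 0)
    (hSb_diag : ∀ i, IsUnit (Sb i i))
    -- with block upper triangular two-sided inverse S̄⁻¹
    (hSbinv_tri : ∀ i j, j < i → Sbinv i j = 0)
    (hSbSbinv : ∀ i j, ∑ k ∈ Finset.range (j + 1), Sb i k * Sbinv k j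
      = if i = j then 1 else 0)
    (hSbinvSb : ∀ i j, ∑ k ∈ Finset.range (j + 1), Sbinv i k * Sb k j
      = if i = j then 1 else 0)
    -- the factorization S g = S̄
    (hfact : ∀ i j, ∑ k ∈ Finset.range (i + 1), S i k * g k j = Sb i j)
    -- g is block Hänkel
    (hhankel : ∀ i j, g (i + 1) j = g i (j + 1))
    -- p_i(z) = Σ_{k≤i} S_{ik} z^k
    (p : ℕ → ℂ → Matrix (Fin N) (Fin N) ℂ)
    (hp : ∀ i z, p i z = ∑ k ∈ Finset.range (i + 1), ((z : ℂ) ^ k) • S i k)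
    -- L_{ij} = Σ_k S_{ik} (S⁻¹)_{k+1,j}
    (L : ℕ → ℕ → Matrix (Fin N) (Fin N) ℂ)
    (hL : ∀ i j, L i j = ∑ k ∈ Finset.range (i + 1), S i k * Sinv (k + 1) j) :
    (∀ z, z • p 0 z = p 1 z + L 0 0 * p 0 z)
    ∧ (∀ i z, z • p (i + 1) z
        = p (i + 2) z + L (i + 1) (i + 1) * p (i + 1) z + L (i + 1) i * p i z) := by
  have shift : ∀ (X : ℕ → Matrix (Fin N) (Fin N) ℂ) (i : ℕ),
      ∑ j ∈ Finset.range (i + 2), L i j * (∑ l ∈ Finset.range (j + 1), S j l * X l)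
        = ∑ k ∈ Finset.range (i + 1), S i k * X (k + 1) := by
    intro X i
    simp only [hL]
    exact sum_shiftConj_mul hS_tri hSinv_tri hSinvS X i
  have hLp : ∀ i z, ∑ j ∈ Finset.range (i + 2), L i j * p j z = z • p i z := by
    intro i z
    have h := shift (fun k => z ^ k • (1 : Matrix (Fin N) (Fin N) ℂ)) i
    simp only [mul_smul_comm, mul_one] at h
    simp only [hp, Finset.smul_sum, smul_smul, ← pow_succ']
    exact h
  have hLSb : ∀ i m, ∑ j ∈ Finset.range (i + 2), L i j * Sb j m = Sb i (m + 1) := by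
    intro i m
    have h := shift (fun k => g k m) i
    simpa only [hhankel, hfact] using h
  have hL_super : ∀ i, L i (i + 1) = 1 := by
    intro i
    rw [hL, Finset.sum_range_succ, Finset.sum_eq_zero, hS_diag, hSinv_diag, zero_add, one_mul]
    intro k hk
    rw [hSinv_tri _ _ (by simpa using hk), mul_zero]
  have hL_low : ∀ i m, m + 1 < i → L i m = 0 := by
    intro i m
    induction m using Nat.strong_induction_on with
    | _ m ih =>
      intro hm
      have h := hLSb i m
      rw [hSb_tri i (m + 1) hm, Finset.sum_eq_single m] at h
      · exact (hSb_diag m).mul_left_eq_zero.1 h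
      · intro j _ hj
        rcases lt_or_gt_of_ne hj with hjm | hjm
        · rw [ih j hjm (by lia), zero_mul]
        · rw [hSb_tri j m hjm, mul_zero]
      · intro hmem
        exact absurd (Finset.mem_range.2 (by lia)) hmem
  refine ⟨fun z => ?_, fun i z => ?_⟩
  · rw [← hLp, Finset.sum_range_succ, Finset.sum_range_one, hL_super, one_mul, add_comm]
  · rw [← hLp, Finset.sum_range_succ, Finset.sum_range_succ, Finset.sum_range_succ, hL_super,
      one_mul, Finset.sum_eq_zero]
    · abel
    · intro j hj
      rw [hL_low _ _ (by simpa using hj), zero_mul]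
end

section
/- Suppose the semi-infinite block matrix g admits a Gaussian factorization S g = S̄ and is (n̄, m̄) multi-graded Hänkel. Then 𝓛 := S Λ^{n̄} S⁻¹ equals S̄ (Λᵗ)^{m̄} S̄⁻¹, i.e. for all i, j, a, b: Σ_{k,c} S_{ik,ac} (S⁻¹)_{k+n_c, j, cb} = Σ_{l,c} S̄_{i, l+m_c, ac} (S̄⁻¹)_{l, j, cb}. Consequently 𝓛 has block band structure: the block 𝓛_{ij} vanishes unless i − m₁ ≤ j ≤ i + n₁, where n₁ := max_a n_a and m₁ := max_b m_b. -/
open Matrix Finset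

/-- Inverting the lower triangular factor: `S g = S̄` gives `g = S⁻¹ S̄`. -/
theorem eq_sum_lower_inv_mul {R : Type*} [Ring R] {g S Sinv Sb : ℕ → ℕ → R}
    (hS_tri : ∀ i j, i < j → S i j = 0)
    (hSinvS : ∀ i j, ∑ k ∈ Finset.range (i + 1), Sinv i k * S k j = if i = j then 1 else 0)
    (hfact : ∀ i j, ∑ k ∈ Finset.range (i + 1), S i k * g k j = Sb i j) (p l : ℕ) :
    g p l = ∑ k ∈ Finset.range (p + 1), Sinv p k * Sb k l := by
  have hext : ∀ k ∈ Finset.range (p + 1),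
      Sb k l = ∑ r ∈ Finset.range (p + 1), S k r * g r l := by
    intro k hk
    rw [← hfact]
    refine Finset.sum_subset (Finset.range_mono (Finset.mem_range.1 hk)) fun r _ hr => ?_
    rw [hS_tri k r (by simpa using hr), zero_mul]
  rw [Finset.sum_congr rfl fun k hk => by rw [hext k hk, Finset.mul_sum], Finset.sum_comm]
  simp_rw [← mul_assoc, ← Finset.sum_mul, hSinvS]
  simp

/-- If `S g = S̄` with `S` lower and `S̄` upper triangular, then `g S̄⁻¹ = S⁻¹`. -/
theorem sum_mul_upper_inv_eq_lower_inv {R : Type*} [Ring R] {g S Sinv Sb Sbinv : ℕ → ℕ → R}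
    (hS_tri : ∀ i j, i < j → S i j = 0)
    (hSinv_tri : ∀ i j, i < j → Sinv i j = 0)
    (hSinvS : ∀ i j, ∑ k ∈ Finset.range (i + 1), Sinv i k * S k j = if i = j then 1 else 0)
    (hSbSbinv : ∀ i j, ∑ k ∈ Finset.range (j + 1), Sb i k * Sbinv k j = if i = j then 1 else 0)
    (hfact : ∀ i j, ∑ k ∈ Finset.range (i + 1), S i k * g k j = Sb i j) (p j : ℕ) :
    ∑ l ∈ Finset.range (j + 1), g p l * Sbinv l j = Sinv p j := by
  simp_rw [eq_sum_lower_inv_mul hS_tri hSinvS hfact p, Finset.sum_mul]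
  rw [Finset.sum_comm]
  simp_rw [mul_assoc, ← Finset.mul_sum, hSbSbinv]
  simpa using fun h => (hSinv_tri p j h).symm

/-- If g admits a Gaussian factorization S g = S̄ and is (n̄,m̄)
multi-graded Hänkel (g_{i+n_a,j,ab} = g_{i,j+m_b,ab}), then
𝓛 := S Λ^{n̄} S⁻¹ = S̄ (Λᵗ)^{m̄} S̄⁻¹, i.e. entrywise
Σ_{k,c} S_{ik,ac} (S⁻¹)_{k+n_c,j,cb} = Σ_{l,c} S̄_{i,l+m_c,ac} (S̄⁻¹)_{l,j,cb}, and
𝓛 has block band structure: 𝓛_{ij} = 0 unless i − m₁ ≤ j ≤ i + n₁, where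
n₁ = max_a n_a and m₁ = max_b m_b. -/
theorem multigraded_hankel_band_structure
    (N : ℕ) (hN : 1 ≤ N)
    (g S Sinv Sb Sbinv : ℕ → ℕ → Matrix (Fin N) (Fin N) ℂ)
    -- S is block lower unitriangular
    (hS_diag : ∀ i, S i i = 1)
    (hS_tri : ∀ i j, i < j → S i j = 0)
    -- with block lower unitriangular two-sided inverse S⁻¹
    (hSinv_diag : ∀ i, Sinv i i = 1)
    (hSinv_tri : ∀ i j, i < j → Sinv i j = 0)
    (hSSinv : ∀ i j, ∑ k ∈ Finset.range (i + 1), S i k * Sinv k j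
      = if i = j then 1 else 0)
    (hSinvS : ∀ i j, ∑ k ∈ Finset.range (i + 1), Sinv i k * S k j
      = if i = j then 1 else 0)
    -- S̄ is block upper triangular with invertible diagonal blocks
    (hSb_tri : ∀ i j, j < i → Sb i j = 0)
    (hSb_diag : ∀ i, IsUnit (Sb i i))
    -- with block upper triangular two-sided inverse S̄⁻¹
    (hSbinv_tri : ∀ i j, j < i → Sbinv i j = 0)
    (hSbSbinv : ∀ i j, ∑ k ∈ Finset.range (j + 1), Sb i k * Sbinv k j
      = if i = j then 1 else 0)
    (hSbinvSb : ∀ i j, ∑ k ∈ Finset.range (j + 1), Sbinv i k * Sb k j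
      = if i = j then 1 else 0)
    -- the factorization S g = S̄
    (hfact : ∀ i j, ∑ k ∈ Finset.range (i + 1), S i k * g k j = Sb i j)
    -- multi-indices of positive integers
    (n m : Fin N → ℕ) (hn : ∀ a, 1 ≤ n a) (hm : ∀ b, 1 ≤ m b)
    -- g is (n̄, m̄) multi-graded Hänkel
    (hhankel : ∀ (i j : ℕ) (a b : Fin N), g (i + n a) j a b = g i (j + m b) a b) :
    (∀ (i j : ℕ) (a b : Fin N),
      (∑ k ∈ Finset.range (i + 1), ∑ c : Fin N, S i k a c * Sinv (k + n c) j c b)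
        = ∑ l ∈ Finset.range (j + 1), ∑ c : Fin N, Sb i (l + m c) a c * Sbinv l j c b)
    ∧ (∀ i j : ℕ,
        (j + Finset.univ.sup m < i ∨ i + Finset.univ.sup n < j) →
        ∀ a b : Fin N,
          (∑ k ∈ Finset.range (i + 1), ∑ c : Fin N, S i k a c * Sinv (k + n c) j c b)
            = 0) := by
  have hdress : ∀ (i j : ℕ) (a b : Fin N),
      (∑ k ∈ Finset.range (i + 1), ∑ c : Fin N, S i k a c * Sinv (k + n c) j c b)
        = ∑ l ∈ Finset.range (j + 1), ∑ c : Fin N, Sb i (l + m c) a c * Sbinv l j c b := by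
    intro i j a b
    have hSinv : ∀ k c, Sinv (k + n c) j c b
        = ∑ l ∈ Finset.range (j + 1), ∑ d, g k (l + m d) c d * Sbinv l j d b := by
      intro k c
      rw [← sum_mul_upper_inv_eq_lower_inv hS_tri hSinv_tri hSinvS hSbSbinv hfact]
      simp only [Matrix.sum_apply, Matrix.mul_apply, hhankel]
    have hSb : ∀ l d, Sb i (l + m d) a d
        = ∑ k ∈ Finset.range (i + 1), ∑ c, S i k a c * g k (l + m d) c d := by
      intro l d
      rw [← hfact]
      simp only [Matrix.sum_apply, Matrix.mul_apply]
    simp_rw [hSinv, hSb, Finset.mul_sum, Finset.sum_mul, mul_assoc]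
    rw [Finset.sum_congr rfl fun k _ => Finset.sum_comm, Finset.sum_comm]
    refine Finset.sum_congr rfl fun l _ => ?_
    rw [Finset.sum_congr rfl fun k _ => Finset.sum_comm]
    exact Finset.sum_comm
  refine ⟨hdress, fun i j hij a b => ?_⟩
  rcases hij with h | h
  · rw [hdress]
    refine Finset.sum_eq_zero fun l hl => Finset.sum_eq_zero fun c _ => ?_
    have hc : m c ≤ Finset.univ.sup m := Finset.le_sup (Finset.mem_univ c)
    have hl := Finset.mem_range.1 hl
    rw [hSb_tri i (l + m c) (by omega), Matrix.zero_apply, zero_mul]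
  · refine Finset.sum_eq_zero fun k hk => Finset.sum_eq_zero fun c _ => ?_
    have hc : n c ≤ Finset.univ.sup n := Finset.le_sup (Finset.mem_univ c)
    have hk := Finset.mem_range.1 hk
    rw [hSinv_tri (k + n c) j (by omega), Matrix.zero_apply, mul_zero]
end

section
/- Suppose the semi-infinite block matrix g admits a Gaussian factorization S g = S̄ and is (n̄, m̄) multi-graded Hänkel. Then the matrix polynomials p_i satisfy the (n₁ + m₁ + 1)-term recurrence relation Σ_{j=max(0, i−m₁)}^{i+n₁} 𝓛_{ij} p_j(z) = p_i(z) · diag(z^{n_1}, …, z^{n_N}) for all i ≥ 0 and all z ∈ ℂ, where 𝓛 := S Λ^{n̄} S⁻¹ has entries 𝓛_{ij,ab} = Σ_{k,c} S_{ik,ac} (S⁻¹)_{k+n_c, j, cb}, n₁ := max_a n_a and m₁ := max_b m_b (the sum is restricted to this range because 𝓛_{ij} = 0 outside the band i − m₁ ≤ j ≤ i + n₁). -/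
open Matrix Finset

/-- A left inverse of a lower triangular array undoes its action on sequences. -/
theorem sum_leftInverse_mul_lowerTriangular_mul {R : Type*} [Ring R] {S T : ℕ → ℕ → R}
    (hS : ∀ i j, i < j → S i j = 0) (hT : ∀ i j, i < j → T i j = 0)
    (hTS : ∀ i j, ∑ k ∈ Finset.range (i + 1), T i k * S k j = if i = j then 1 else 0)
    (f : ℕ → R) {r M : ℕ} (hr : r < M) :
    ∑ l ∈ Finset.range M, T r l * ∑ k ∈ Finset.range (l + 1), S l k * f k = f r := by
  have hcut : ∑ l ∈ Finset.range (r + 1), T r l * ∑ k ∈ Finset.range (l + 1), S l k * f k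
      = ∑ l ∈ Finset.range M, T r l * ∑ k ∈ Finset.range (l + 1), S l k * f k := by
    refine Finset.sum_subset (Finset.range_subset_range.2 hr) fun l _ hl => ?_
    rw [hT r l (by simpa [Nat.lt_succ_iff] using hl), zero_mul]
  have hext : ∀ l ∈ Finset.range (r + 1), T r l * ∑ k ∈ Finset.range (l + 1), S l k * f k
      = ∑ k ∈ Finset.range (r + 1), T r l * S l k * f k := by
    intro l hl
    rw [Finset.mul_sum]
    simp only [← mul_assoc]
    refine Finset.sum_subset
      (Finset.range_subset_range.2 (Nat.succ_le_of_lt (Finset.mem_range.1 hl))) fun k _ hk => ?_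
    rw [hS l k (by simpa [Nat.lt_succ_iff] using hk), mul_zero, zero_mul]
  rw [← hcut, Finset.sum_congr rfl hext, Finset.sum_comm]
  simp only [← Finset.sum_mul, hTS]
  simp

/-- The array `S Λ^n S⁻¹` sends the sequence `S f` to `S (Λ^n f)`. -/
theorem sum_conjShift_mul_lowerTriangular_mul {ι R : Type*} [Fintype ι] [DecidableEq ι] [Ring R]
    {S T L : ℕ → ℕ → Matrix ι ι R}
    (hS : ∀ i j, i < j → S i j = 0) (hT : ∀ i j, i < j → T i j = 0)
    (hTS : ∀ i j, ∑ k ∈ Finset.range (i + 1), T i k * S k j = if i = j then 1 else 0)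
    (n : ι → ℕ)
    (hL : ∀ i j, L i j = Matrix.of fun a b =>
      ∑ k ∈ Finset.range (i + 1), ∑ c : ι, S i k a c * T (k + n c) j c b)
    (f : ℕ → Matrix ι ι R) {i M : ℕ} (hM : ∀ c, i + n c < M) :
    ∑ l ∈ Finset.range M, L i l * ∑ k ∈ Finset.range (l + 1), S l k * f k
      = ∑ k ∈ Finset.range (i + 1), S i k * Matrix.of fun c b => f (k + n c) c b := by
  have hL' : ∀ l, L i l = ∑ k ∈ Finset.range (i + 1),
      S i k * Matrix.of fun c b => T (k + n c) l c b := by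
    intro l
    ext a b
    simp [hL, Matrix.sum_apply, Matrix.mul_apply]
  simp only [hL', Finset.sum_mul]
  rw [Finset.sum_comm]
  refine Finset.sum_congr rfl fun k hk => ?_
  simp only [Matrix.mul_assoc, ← Finset.mul_sum]
  congr 1
  ext c b
  have hlt : k + n c < M := by
    have := hM c
    have := Finset.mem_range.1 hk
    omega
  have h := congrFun (congrFun (sum_leftInverse_mul_lowerTriangular_mul hS hT hTS f hlt) c) b
  rw [Matrix.of_apply, ← h, Matrix.sum_apply, Matrix.sum_apply]
  rfl

/-- A row vector annihilated by the first columns of an upper triangular array with invertible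
diagonal vanishes in those positions. -/
theorem eq_zero_of_sum_mul_upperTriangular {R : Type*} [Ring R] {U : ℕ → ℕ → R}
    (hU : ∀ i j, j < i → U i j = 0) (hdiag : ∀ i, IsUnit (U i i)) {v : ℕ → R} {M J : ℕ}
    (hJ : J ≤ M) (hv : ∀ j < J, ∑ l ∈ Finset.range M, v l * U l j = 0) :
    ∀ j < J, v j = 0 := by
  intro j
  induction j using Nat.strong_induction_on with
  | _ j ih =>
    intro hj
    have h := hv j hj
    rw [Finset.sum_eq_single_of_mem j (Finset.mem_range.2 (hj.trans_le hJ))] at h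
    · exact (hdiag j).mul_left_eq_zero.1 h
    · intro l _ hl
      rcases lt_or_gt_of_ne hl with hlt | hgt
      · rw [ih l hlt (hlt.trans hj), zero_mul]
      · rw [hU l j hgt, mul_zero]

/-- If g admits a Gaussian factorization S g = S̄ and is (n̄,m̄)
multi-graded Hänkel, then the matrix polynomials p_i(z) = Σ_{k≤i} S_{ik} z^k satisfy
the (n₁+m₁+1)-term recurrence Σ_{j=max(0,i−m₁)}^{i+n₁} 𝓛_{ij} p_j(z)
= p_i(z) diag(z^{n_1},…,z^{n_N}), where 𝓛_{ij,ab} = Σ_{k,c} S_{ik,ac} (S⁻¹)_{k+n_c,j,cb},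
n₁ = max_a n_a and m₁ = max_b m_b. -/
theorem multigraded_hankel_recurrence
    (N : ℕ) (hN : 1 ≤ N)
    (g S Sinv Sb Sbinv : ℕ → ℕ → Matrix (Fin N) (Fin N) ℂ)
    -- S is block lower unitriangular
    (hS_diag : ∀ i, S i i = 1)
    (hS_tri : ∀ i j, i < j → S i j = 0)
    -- with block lower unitriangular two-sided inverse S⁻¹
    (hSinv_diag : ∀ i, Sinv i i = 1)
    (hSinv_tri : ∀ i j, i < j → Sinv i j = 0)
    (hSSinv : ∀ i j, ∑ k ∈ Finset.range (i + 1), S i k * Sinv k j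
      = if i = j then 1 else 0)
    (hSinvS : ∀ i j, ∑ k ∈ Finset.range (i + 1), Sinv i k * S k j
      = if i = j then 1 else 0)
    -- S̄ is block upper triangular with invertible diagonal blocks
    (hSb_tri : ∀ i j, j < i → Sb i j = 0)
    (hSb_diag : ∀ i, IsUnit (Sb i i))
    -- with block upper triangular two-sided inverse S̄⁻¹
    (hSbinv_tri : ∀ i j, j < i → Sbinv i j = 0)
    (hSbSbinv : ∀ i j, ∑ k ∈ Finset.range (j + 1), Sb i k * Sbinv k j
      = if i = j then 1 else 0)
    (hSbinvSb : ∀ i j, ∑ k ∈ Finset.range (j + 1), Sbinv i k * Sb k j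
      = if i = j then 1 else 0)
    -- the factorization S g = S̄
    (hfact : ∀ i j, ∑ k ∈ Finset.range (i + 1), S i k * g k j = Sb i j)
    -- multi-indices of positive integers
    (n m : Fin N → ℕ) (hn : ∀ a, 1 ≤ n a) (hm : ∀ b, 1 ≤ m b)
    -- g is (n̄, m̄) multi-graded Hänkel
    (hhankel : ∀ (i j : ℕ) (a b : Fin N), g (i + n a) j a b = g i (j + m b) a b)
    -- p_i(z) = Σ_{k≤i} S_{ik} z^k
    (p : ℕ → ℂ → Matrix (Fin N) (Fin N) ℂ)
    (hp : ∀ i z, p i z = ∑ k ∈ Finset.range (i + 1), ((z : ℂ) ^ k) • S i k)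
    -- 𝓛 = S Λ^{n̄} S⁻¹
    (L : ℕ → ℕ → Matrix (Fin N) (Fin N) ℂ)
    (hL : ∀ i j, L i j = Matrix.of fun a b =>
      ∑ k ∈ Finset.range (i + 1), ∑ c : Fin N, S i k a c * Sinv (k + n c) j c b) :
    ∀ (i : ℕ) (z : ℂ),
      ∑ j ∈ Finset.Icc (i - Finset.univ.sup m) (i + Finset.univ.sup n), L i j * p j z
        = p i z * Matrix.diagonal (fun a => z ^ n a) := by
  intro i z
  have hM : ∀ c, i + n c < i + Finset.univ.sup n + 1 := fun c =>
    Nat.lt_succ_of_le (Nat.add_le_add_left (Finset.le_sup (Finset.mem_univ c)) i)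
  have key := fun f => sum_conjShift_mul_lowerTriangular_mul hS_tri hSinv_tri hSinvS n hL f hM
  have hlow : ∀ j < i - Finset.univ.sup m, L i j = 0 := by
    refine eq_zero_of_sum_mul_upperTriangular hSb_tri hSb_diag
      (M := i + Finset.univ.sup n + 1) (by omega) fun j hj => ?_
    have h := key fun k => g k j
    simp only [hfact] at h
    rw [h]
    ext a b
    have hlt : j + m b < i := by
      have : m b ≤ Finset.univ.sup m := Finset.le_sup (Finset.mem_univ b)
      omega
    have h0 := congrFun (congrFun ((hfact i (j + m b)).trans (hSb_tri _ _ hlt)) a) b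
    rw [← h0]
    simp [Matrix.sum_apply, Matrix.mul_apply, hhankel]
  have hband : ∑ j ∈ Finset.Icc (i - Finset.univ.sup m) (i + Finset.univ.sup n), L i j * p j z
      = ∑ j ∈ Finset.range (i + Finset.univ.sup n + 1), L i j * p j z := by
    refine Finset.sum_subset (fun j hj => ?_) fun j hj hj' => ?_
    · rw [Finset.mem_Icc] at hj
      exact Finset.mem_range.2 (by omega)
    · rw [Finset.mem_range] at hj
      rw [Finset.mem_Icc] at hj'
      rw [hlow j (by omega), zero_mul]
  have hp' : ∀ j, p j z = ∑ k ∈ Finset.range (j + 1),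
      S j k * (z ^ k • (1 : Matrix (Fin N) (Fin N) ℂ)) := by
    intro j
    simp [hp]
  have h := key fun k => z ^ k • (1 : Matrix (Fin N) (Fin N) ℂ)
  simp only [← hp'] at h
  rw [hband, h, hp', Finset.sum_mul]
  refine Finset.sum_congr rfl fun k _ => ?_
  rw [Matrix.mul_assoc]
  congr 1
  ext c b
  by_cases hcb : c = b
  · subst hcb
    simp [pow_add]
  · simp [hcb]
end
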